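/- Let β > 0, α > 0 and d ≥ 1. There exist constants 0 < c ≤ C < ∞ depending only on β and α such that for all φ, ξ ∈ ℝ^d with (φ,ξ) ≠ (0,0) and all s ∈ ℝ, one has c·W(s,φ,ξ)^{−2β} ≤ ∫_s^{∞} K(t,s,φ,ξ)^α dt ≤ C·W(s,φ,ξ)^{−2β}. -/

import Mathlib

open MeasureTheory Real

/-- The weight `W(t,φ,ξ) = max(‖ξ - tφ‖, ‖φ‖^{1/(1+2β)})`. -/
noncomputable def Wgt (β : ℝ) {d : ℕ} (t : ℝ) (φ ξ : EuclideanSpace ℝ (Fin d)) : ℝ :=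
  max ‖ξ - t • φ‖ (‖φ‖ ^ (1 / (1 + 2 * β)))

/-- The Kolmogorov kernel `K(t,s,φ,ξ) = exp(-∫_s^t ‖ξ - τφ‖^{2β} dτ)`. -/
noncomputable def Kker (β : ℝ) {d : ℕ} (t s : ℝ) (φ ξ : EuclideanSpace ℝ (Fin d)) : ℝ :=
  Real.exp (-(∫ τ in s..t, ‖ξ - τ • φ‖ ^ (2 * β)))

section

variable {d : ℕ} {β : ℝ} {φ ξ : EuclideanSpace ℝ (Fin d)}

lemma mul_le_intervalIntegral_of_le_on_subinterval {f : ℝ → ℝ} (hf : Continuous f)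
    (hf0 : ∀ x, 0 ≤ f x) {s t a b k : ℝ} (hsa : s ≤ a) (hab : a ≤ b) (hbt : b ≤ t)
    (hk : ∀ x ∈ Set.Icc a b, k ≤ f x) : (b - a) * k ≤ ∫ x in s..t, f x := by
  calc (b - a) * k = ∫ _ in a..b, k := by simp
    _ ≤ ∫ x in a..b, f x :=
      intervalIntegral.integral_mono_on hab (by simp) (hf.intervalIntegrable _ _) hk
    _ ≤ ∫ x in s..t, f x :=
      intervalIntegral.integral_mono_interval hsa hab hbt
        (Filter.Eventually.of_forall hf0) (hf.intervalIntegrable _ _)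

lemma continuous_norm_sub_smul_rpow (hβ : 0 < β) (φ ξ : EuclideanSpace ℝ (Fin d)) :
    Continuous fun τ : ℝ => ‖ξ - τ • φ‖ ^ (2 * β) :=
  Continuous.rpow_const (by fun_prop) fun _ => Or.inr (by positivity)

lemma Wgt_pos (h : (φ, ξ) ≠ (0, 0)) (s : ℝ) : 0 < Wgt β s φ ξ := by
  by_cases hφ : φ = 0
  · subst hφ
    have hξ : ξ ≠ 0 := fun h0 => h (by rw [h0])
    exact lt_max_of_lt_left (by simpa using hξ)
  · exact lt_max_of_lt_right (rpow_pos_of_pos (norm_pos_iff.mpr hφ) _)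

lemma norm_rpow_rpow_eq (hβ : 0 < β) (φ : EuclideanSpace ℝ (Fin d)) :
    (‖φ‖ ^ (1 / (1 + 2 * β))) ^ (1 + 2 * β) = ‖φ‖ := by
  rw [← rpow_mul (norm_nonneg _), one_div_mul_cancel (by positivity), rpow_one]

lemma norm_le_Wgt_mul (hβ : 0 < β) (h : (φ, ξ) ≠ (0, 0)) (s : ℝ) :
    ‖φ‖ ≤ Wgt β s φ ξ * Wgt β s φ ξ ^ (2 * β) := by
  have hW := Wgt_pos (β := β) h s
  calc ‖φ‖ = (‖φ‖ ^ (1 / (1 + 2 * β))) ^ (1 + 2 * β) := (norm_rpow_rpow_eq hβ φ).symm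
    _ ≤ Wgt β s φ ξ ^ (1 + 2 * β) := by
      gcongr
      exact le_max_right _ _
    _ = _ := by rw [rpow_add hW, rpow_one]

lemma norm_eq_Wgt_mul_of_lt (hβ : 0 < β) (h : (φ, ξ) ≠ (0, 0)) {s : ℝ}
    (hlt : ‖ξ - s • φ‖ < Wgt β s φ ξ) :
    ‖φ‖ = Wgt β s φ ξ * Wgt β s φ ξ ^ (2 * β) := by
  have hW := Wgt_pos (β := β) h s
  have hWeq : Wgt β s φ ξ = ‖φ‖ ^ (1 / (1 + 2 * β)) := by
    rcases max_choice ‖ξ - s • φ‖ (‖φ‖ ^ (1 / (1 + 2 * β))) with h1 | h1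
    · exact absurd h1 hlt.ne'
    · exact h1
  calc ‖φ‖ = (‖φ‖ ^ (1 / (1 + 2 * β))) ^ (1 + 2 * β) := (norm_rpow_rpow_eq hβ φ).symm
    _ = Wgt β s φ ξ ^ (1 + 2 * β) := by rw [hWeq]
    _ = _ := by rw [rpow_add hW, rpow_one]

/-- On the time scale `W ^ (-2β)` the phase stays bounded. -/
lemma phase_le (hβ : 0 < β) (h : (φ, ξ) ≠ (0, 0)) {s t : ℝ} (hst : s ≤ t)
    (ht : (t - s) * Wgt β s φ ξ ^ (2 * β) ≤ 1) :
    ∫ τ in s..t, ‖ξ - τ • φ‖ ^ (2 * β) ≤ 2 ^ (2 * β) := by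
  have hW := Wgt_pos (β := β) h s
  have hφ := norm_le_Wgt_mul hβ h s
  set W := Wgt β s φ ξ
  have hη : ‖ξ - s • φ‖ ≤ W := le_max_left _ _
  have hm : 0 < W ^ (2 * β) := rpow_pos_of_pos hW _
  have hbound : ∀ τ ∈ Set.Icc s t, ‖ξ - τ • φ‖ ^ (2 * β) ≤ (2 * W) ^ (2 * β) := by
    intro τ hτ
    gcongr
    have h1 : ξ - τ • φ = (ξ - s • φ) - (τ - s) • φ := by module
    have h2 : ‖ξ - τ • φ‖ ≤ ‖ξ - s • φ‖ + (τ - s) * ‖φ‖ := by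
      rw [h1]
      refine (norm_sub_le _ _).trans_eq ?_
      rw [norm_smul, norm_of_nonneg (sub_nonneg.mpr hτ.1)]
    have h3 : (τ - s) * ‖φ‖ ≤ (t - s) * (W * W ^ (2 * β)) := by
      have := hτ.2
      gcongr
    nlinarith
  calc ∫ τ in s..t, ‖ξ - τ • φ‖ ^ (2 * β) ≤ ∫ _ in s..t, (2 * W) ^ (2 * β) :=
        intervalIntegral.integral_mono_on hst
          ((continuous_norm_sub_smul_rpow hβ φ ξ).intervalIntegrable _ _) (by simp) hbound
    _ = (t - s) * W ^ (2 * β) * 2 ^ (2 * β) := by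
      rw [mul_rpow zero_le_two hW.le]
      simp
      ring
    _ ≤ 1 * 2 ^ (2 * β) := by gcongr
    _ = _ := one_mul _

/-- The phase grows at least linearly on the time scale `W ^ (-2β)`: the path `ξ - τφ` stays away
from the origin either on the first or on the last third of a long enough time interval. -/
lemma le_phase (hβ : 0 < β) (h : (φ, ξ) ≠ (0, 0)) {s t : ℝ} (hst : s ≤ t) :
    (1 / 4) ^ (2 * β) / 3 * ((t - s) * Wgt β s φ ξ ^ (2 * β) - 3 / 2) ≤
      ∫ τ in s..t, ‖ξ - τ • φ‖ ^ (2 * β) := by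
  have hW := Wgt_pos (β := β) h s
  have hφ := norm_eq_Wgt_mul_of_lt (s := s) hβ h
  set W := Wgt β s φ ξ
  have hm : 0 < W ^ (2 * β) := rpow_pos_of_pos hW _
  have hq : (0 : ℝ) < (1 / 4) ^ (2 * β) := by positivity
  have hcont := continuous_norm_sub_smul_rpow hβ φ ξ
  have hnn : ∀ τ : ℝ, 0 ≤ ‖ξ - τ • φ‖ ^ (2 * β) := fun _ => by positivity
  rcases lt_or_ge ((t - s) * W ^ (2 * β)) (3 / 2) with hr | hr
  · exact (mul_nonpos_of_nonneg_of_nonpos (by positivity) (by linarith)).trans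
      (intervalIntegral.integral_nonneg hst fun τ _ => hnn τ)
  have key : (1 / 4) ^ (2 * β) / 3 * ((t - s) * W ^ (2 * β) - 3 / 2) ≤
      (t - s) / 3 * (1 / 4 * W) ^ (2 * β) := by
    rw [mul_rpow (by norm_num) hW.le]
    nlinarith
  refine key.trans ?_
  by_cases hA : ∀ u ∈ Set.Icc s (s + (t - s) / 3), 1 / 4 * W ≤ ‖ξ - u • φ‖
  · have := mul_le_intervalIntegral_of_le_on_subinterval (s := s) (t := t) hcont hnn le_rfl
      (by linarith : s ≤ s + (t - s) / 3) (by linarith)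
      (k := (1 / 4 * W) ^ (2 * β)) fun u hu => by
        have := hA u hu
        gcongr
    rwa [add_sub_cancel_left] at this
  push Not at hA
  obtain ⟨u, hu, hgu⟩ := hA
  have hB : ∀ v ∈ Set.Icc (t - (t - s) / 3) t, 1 / 4 * W ≤ ‖ξ - v • φ‖ := by
    intro v hv
    by_contra! hgv
    have huv : (t - s) / 3 ≤ v - u := by linarith [hu.2, hv.1]
    have hd : (v - u) * ‖φ‖ ≤ ‖ξ - u • φ‖ + ‖ξ - v • φ‖ := by
      rw [← norm_of_nonneg (by linarith : 0 ≤ v - u), ← norm_smul,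
        (by module : (v - u) • φ = (ξ - u • φ) - (ξ - v • φ))]
      exact norm_sub_le _ _
    have hd3 : (t - s) / 3 * ‖φ‖ < 1 / 2 * W := by
      have := mul_le_mul_of_nonneg_right huv (norm_nonneg φ)
      linarith
    have hη : ‖ξ - s • φ‖ ≤ ‖ξ - u • φ‖ + (u - s) * ‖φ‖ := by
      rw [← norm_of_nonneg (by linarith [hu.1] : 0 ≤ u - s), ← norm_smul,
        (by module : ξ - s • φ = (ξ - u • φ) + (u - s) • φ)]
      exact norm_add_le _ _
    have hus : (u - s) * ‖φ‖ ≤ (t - s) / 3 * ‖φ‖ := by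
      gcongr
      linarith [hu.2]
    have hφ' := hφ (by linarith)
    rw [hφ'] at hd3
    nlinarith
  have := mul_le_intervalIntegral_of_le_on_subinterval (s := s) (t := t) hcont hnn
    (by linarith : s ≤ t - (t - s) / 3) (by linarith) le_rfl
    (k := (1 / 4 * W) ^ (2 * β)) fun v hv => by
      have := hB v hv
      gcongr
  rwa [sub_sub_cancel] at this

lemma Kker_rpow (α t s : ℝ) :
    Kker β t s φ ξ ^ α = exp (-(α * ∫ τ in s..t, ‖ξ - τ • φ‖ ^ (2 * β))) := by
  rw [Kker, ← exp_mul]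
  ring_nf

lemma continuous_Kker_rpow (hβ : 0 < β) (α s : ℝ) (φ ξ : EuclideanSpace ℝ (Fin d)) :
    Continuous fun t => Kker β t s φ ξ ^ α := by
  simp only [Kker_rpow]
  have := intervalIntegral.continuous_primitive
    (fun a b => (continuous_norm_sub_smul_rpow hβ φ ξ).intervalIntegrable (μ := volume) a b) s
  fun_prop

end

/-- Estimate (2.13): `∫_s^∞ K(t,s,φ,ξ)^α dt ≃ W(s,φ,ξ)^{-2β}` with constants depending
only on `β` and `α`. -/
theorem kernel_integral_in_t_comparison (β α : ℝ) (hβ : 0 < β) (hα : 0 < α) :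
    ∃ c C : ℝ, 0 < c ∧ c ≤ C ∧
      ∀ (d : ℕ), 1 ≤ d → ∀ φ ξ : EuclideanSpace ℝ (Fin d), (φ, ξ) ≠ (0, 0) →
        ∀ s : ℝ,
          c * Wgt β s φ ξ ^ (-(2 * β)) ≤ (∫ t in Set.Ici s, Kker β t s φ ξ ^ α) ∧
          (∫ t in Set.Ici s, Kker β t s φ ξ ^ α) ≤ C * Wgt β s φ ξ ^ (-(2 * β)) := by
  set a : ℝ := α * ((1 / 4) ^ (2 * β) / 3) with ha_def
  have ha : 0 < a := by positivity
  refine ⟨exp (-(α * 2 ^ (2 * β))), max (exp (-(α * 2 ^ (2 * β)))) (exp (a * (3 / 2)) / a),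
    exp_pos _, le_max_left _ _, ?_⟩
  intro d _ φ ξ h s
  have hW := Wgt_pos (β := β) h s
  have hphase_le := fun t => phase_le (s := s) (t := t) hβ h
  have hle_phase := fun t => le_phase (s := s) (t := t) hβ h
  rw [rpow_neg hW.le]
  have hm : 0 < Wgt β s φ ξ ^ (2 * β) := rpow_pos_of_pos hW _
  set m := Wgt β s φ ξ ^ (2 * β)
  have ham : -(a * m) < 0 := neg_neg_of_pos (by positivity)
  have hdom : ∀ t ∈ Set.Ioi s, Kker β t s φ ξ ^ α ≤
      exp (a * (3 / 2) + a * m * s) * exp (-(a * m) * t) := by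
    intro t ht
    rw [Kker_rpow, ← exp_add, exp_le_exp]
    have := mul_le_mul_of_nonneg_left (hle_phase t (le_of_lt ht)) hα.le
    rw [ha_def]
    linarith
  have hint_dom : IntegrableOn
      (fun t => exp (a * (3 / 2) + a * m * s) * exp (-(a * m) * t)) (Set.Ioi s) :=
    (integrableOn_exp_mul_Ioi ham s).const_mul _
  have hnn : ∀ t, 0 ≤ Kker β t s φ ξ ^ α := fun t => rpow_nonneg (exp_pos _).le _
  have hint : IntegrableOn (fun t => Kker β t s φ ξ ^ α) (Set.Ioi s) := by
    refine hint_dom.mono' (continuous_Kker_rpow hβ α s φ ξ).aestronglyMeasurable ?_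
    filter_upwards [ae_restrict_mem measurableSet_Ioi] with t ht
    rw [norm_of_nonneg (hnn t)]
    exact hdom t ht
  rw [integral_Ici_eq_integral_Ioi]
  constructor
  · have hs : s ≤ s + m⁻¹ := by
      have := inv_pos.mpr hm
      linarith
    calc exp (-(α * 2 ^ (2 * β))) * m⁻¹
        = ∫ _ in s..(s + m⁻¹), exp (-(α * 2 ^ (2 * β))) := by
          simp [mul_comm]
      _ ≤ ∫ t in s..(s + m⁻¹), Kker β t s φ ξ ^ α := by
          refine intervalIntegral.integral_mono_on hs (by simp)
            ((continuous_Kker_rpow hβ α s φ ξ).intervalIntegrable _ _) fun t ht => ?_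
          rw [Kker_rpow, exp_le_exp, neg_le_neg_iff]
          refine mul_le_mul_of_nonneg_left (hphase_le t ht.1 ?_) hα.le
          calc (t - s) * m ≤ m⁻¹ * m := by
                gcongr
                linarith [ht.2]
            _ = 1 := inv_mul_cancel₀ hm.ne'
      _ = ∫ t in Set.Ioc s (s + m⁻¹), Kker β t s φ ξ ^ α :=
          intervalIntegral.integral_of_le hs
      _ ≤ ∫ t in Set.Ioi s, Kker β t s φ ξ ^ α :=
          setIntegral_mono_set hint (Filter.Eventually.of_forall hnn)
            Set.Ioc_subset_Ioi_self.eventuallyLE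
  · calc ∫ t in Set.Ioi s, Kker β t s φ ξ ^ α
        ≤ ∫ t in Set.Ioi s, exp (a * (3 / 2) + a * m * s) * exp (-(a * m) * t) :=
          setIntegral_mono_on hint hint_dom measurableSet_Ioi hdom
      _ = exp (a * (3 / 2)) / a * m⁻¹ := by
          rw [integral_const_mul, integral_exp_mul_Ioi ham, neg_div_neg_eq, ← mul_div_assoc,
            ← exp_add, add_assoc, neg_mul, add_neg_cancel, add_zero]
          field_simp
      _ ≤ _ := by
          gcongr
          exact le_max_right _ _
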